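/- For every ω ≥ 1 and all functions f, g on the same bounded hyper-rectangle, ‖f + g‖_{R^ω} ≤ (‖f‖_{R^ω}^{2ω/(1+2ω)} + ‖g‖_{R^ω}^{2ω/(1+2ω)})^{(1+2ω)/(2ω)} (approximate subadditivity of the ResNet norm under addition). -/

import Mathlib

open scoped BigOperators

noncomputable section

/-! ## Basic norms on vector-valued functions on a hyper-rectangle -/

/-- Euclidean norm of a vector in `Fin d → ℝ`. -/
def euclNorm {d : ℕ} (v : Fin d → ℝ) : ℝ := Real.sqrt (∑ i, (v i) ^ 2)

/-- The hyper-rectangle with lower corner `a` and (positive) side lengths `s`. -/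
def hyperRect {d : ℕ} (a s : Fin d → ℝ) : Set (Fin d → ℝ) :=
  {x | ∀ i, a i ≤ x i ∧ x i ≤ a i + s i}

/-- Values whose supremum is the sup (L∞) norm over the hyper-rectangle. -/
def supSet {din dout : ℕ} (a s : Fin din → ℝ)
    (f : (Fin din → ℝ) → Fin dout → ℝ) : Set ℝ :=
  {v | ∃ x ∈ hyperRect a s, ∃ o : Fin dout, v = |f x o|}

/-- Sup (L∞) norm over the hyper-rectangle. -/
def supNormR {din dout : ℕ} (a s : Fin din → ℝ)
    (f : (Fin din → ℝ) → Fin dout → ℝ) : ℝ :=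
  sSup (supSet a s f)

/-- L²(π) norm of a vector valued function. -/
def l2NormR {din dout : ℕ} (π : MeasureTheory.Measure (Fin din → ℝ))
    (f : (Fin din → ℝ) → Fin dout → ℝ) : ℝ :=
  Real.sqrt (∫ x, ∑ o, (f x o) ^ 2 ∂π)

/-- Values whose supremum is the Hölder seminorm over the hyper-rectangle. -/
def holderSet {din dout : ℕ} (a s : Fin din → ℝ) (α : ℝ)
    (f : (Fin din → ℝ) → Fin dout → ℝ) : Set ℝ :=
  {v | ∃ x ∈ hyperRect a s, ∃ y ∈ hyperRect a s, x ≠ y ∧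
    v = euclNorm (fun o => f x o - f y o) / (euclNorm (fun i => x i - y i)) ^ α}

/-- Hölder seminorm with exponent `α` over the hyper-rectangle. -/
def holderNormR {din dout : ℕ} (a s : Fin din → ℝ) (α : ℝ)
    (f : (Fin din → ℝ) → Fin dout → ℝ) : ℝ :=
  sSup (holderSet a s α f)

/-! ## Binary circuits -/

/-- Types of gates of a binary circuit. -/
inductive GateOp | and | or | not

/-- A binary circuit with `nin` input bits and `nout` output bits, given as a list of
gates in topological order: gate `k` may take its inputs among the `nin` input bits and
the outputs of the gates `0, …, k-1`.  An output of the circuit is either the value of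
one of the gates or (`none`) the constant `0`/`false`, so that the only circuit with
zero gates computes the constant `0` function. -/
structure Circuit (nin nout : ℕ) where
  size : ℕ
  op : Fin size → GateOp
  in1 : (k : Fin size) → Fin (nin + k.1)
  in2 : (k : Fin size) → Fin (nin + k.1)
  out : Fin nout → Option (Fin size)

namespace Circuit

variable {nin nout : ℕ}

/-- The boolean value carried by node `i` (inputs for `i < nin`, then gates). -/
def node (C : Circuit nin nout) (x : Fin nin → Bool) (i : ℕ) : Bool :=
  if h : i < nin then x ⟨i, h⟩
  else if h2 : i - nin < C.size then
    match C.op ⟨i - nin, h2⟩ with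
    | GateOp.and => node C x (C.in1 ⟨i - nin, h2⟩).1 && node C x (C.in2 ⟨i - nin, h2⟩).1
    | GateOp.or => node C x (C.in1 ⟨i - nin, h2⟩).1 || node C x (C.in2 ⟨i - nin, h2⟩).1
    | GateOp.not => !(node C x (C.in1 ⟨i - nin, h2⟩).1)
  else false
termination_by i
decreasing_by
  all_goals first
    | (have _h1 := (C.in1 ⟨i - nin, h2⟩).isLt; omega)
    | (have _h1 := (C.in2 ⟨i - nin, h2⟩).isLt; omega)

/-- Evaluation of the circuit. -/
def eval (C : Circuit nin nout) (x : Fin nin → Bool) (o : Fin nout) : Bool :=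
  match C.out o with
  | none => false
  | some k => C.node x (nin + k.1)

/-- The layered `p`-size `|C|_p = min (∑_ℓ n_ℓ^p)^{1/p}`, minimized over all ways
of organizing the gates into layers compatible with the wiring (inputs sit below
layer `1`, and each gate only uses gates from strictly earlier layers). -/
def layeredSize (C : Circuit nin nout) (p : ℝ) : ℝ :=
  sInf {v : ℝ | ∃ lay : Fin C.size → ℕ,
    (∀ k, 1 ≤ lay k ∧ lay k ≤ C.size) ∧
    (∀ (k j : Fin C.size), ((C.in1 k).1 = nin + j.1 ∨ (C.in2 k).1 = nin + j.1) → lay j < lay k) ∧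
    v = (∑ ℓ ∈ Finset.range (C.size + 1),
          ((Finset.univ.filter fun k => lay k = ℓ).card : ℝ) ^ p) ^ p⁻¹}

end Circuit

/-! ## Real-to-bin computation: the real-valued function associated to a circuit -/

/-- Index (in `{0, …, 2^M - 1}`) of the grid point representing coordinate `i` of `x`,
for the uniform `2^M`-point grid along the side `[a i, a i + s i]`. -/
def gridIdx {d : ℕ} (a s : Fin d → ℝ) (M : ℕ) (x : Fin d → ℝ) (i : Fin d) : ℕ :=
  min ⌊(x i - a i) / s i * 2 ^ M⌋₊ (2 ^ M - 1)

/-- The real function computed by a circuit `C` on the hyper-rectangle: each input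
coordinate is encoded by the `M`-bit binary expansion of its grid position, and each
output coordinate is decoded as `lam * ∑_{m=1}^{Mout} 2^{-m}·(m-th output bit)`
(`lam` is the scale of the decoding map, which does not affect the circuit size). -/
def circuitFun {din dout : ℕ} (a s : Fin din → ℝ) (M Mout : ℕ)
    (C : Circuit (din * M) (dout * Mout)) (lam : ℝ)
    (x : Fin din → ℝ) (o : Fin dout) : ℝ :=
  lam * ∑ m : Fin Mout,
    ((2 : ℝ) ^ (m.1 + 1))⁻¹ *
      (if C.eval
          (fun idx => Nat.testBit (gridIdx a s M x (finProdFinEquiv.symm idx).1)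
            ((finProdFinEquiv.symm idx).2 : Fin M).1)
          (finProdFinEquiv (o, m)) then 1 else 0)

/-- Layered sizes of circuits `ε`-approximating `f` in the norm `N`. -/
def CpSet {din dout : ℕ} (a s : Fin din → ℝ) (p : ℝ)
    (N : ((Fin din → ℝ) → Fin dout → ℝ) → ℝ)
    (f : (Fin din → ℝ) → Fin dout → ℝ) (ε : ℝ) : Set ℝ :=
  {v | ∃ (M Mout : ℕ) (C : Circuit (din * M) (dout * Mout)) (lam : ℝ),
    N (fun x o => circuitFun a s M Mout C lam x o - f x o) ≤ ε ∧ v = C.layeredSize p}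

/-- `C_p(f, ε; N)`: minimal layered `p`-size of a circuit `ε`-approximating `f` in `N`. -/
def Cp {din dout : ℕ} (a s : Fin din → ℝ) (p : ℝ)
    (N : ((Fin din → ℝ) → Fin dout → ℝ) → ℝ)
    (f : (Fin din → ℝ) → Fin dout → ℝ) (ε : ℝ) : ℝ :=
  sInf (CpSet a s p N f ε)

/-- Values whose supremum is `‖f‖^γ` for the HTMC norm. -/
def HTMCSet {din dout : ℕ} (a s : Fin din → ℝ) (γ p : ℝ)
    (N : ((Fin din → ℝ) → Fin dout → ℝ) → ℝ)
    (f : (Fin din → ℝ) → Fin dout → ℝ) : Set ℝ :=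
  {v | ∃ ε : ℝ, 0 < ε ∧ v = ε ^ γ * Cp a s p N f ε}

/-- The HTMC norm `‖f‖_{H^γ_p(N)} = (sup_{ε>0} ε^γ C_p(f,ε;N))^{1/γ}`. -/
def HTMCNorm {din dout : ℕ} (a s : Fin din → ℝ) (γ p : ℝ)
    (N : ((Fin din → ℝ) → Fin dout → ℝ) → ℝ)
    (f : (Fin din → ℝ) → Fin dout → ℝ) : ℝ :=
  (sSup (HTMCSet a s γ p N f)) ^ γ⁻¹

/-- Finiteness of the HTMC norm: `f` is approximable by circuits at every accuracy,
with `sup_{ε>0} ε^γ C_p(f,ε;N) < ∞`. -/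
def HTMCFin {din dout : ℕ} (a s : Fin din → ℝ) (γ p : ℝ)
    (N : ((Fin din → ℝ) → Fin dout → ℝ) → ℝ)
    (f : (Fin din → ℝ) → Fin dout → ℝ) : Prop :=
  (∀ ε : ℝ, 0 < ε → (CpSet a s p N f ε).Nonempty) ∧ BddAbove (HTMCSet a s γ p N f)

/-! ## ResNets -/

/-- A ResNet of depth `L`, width `w` and hidden dimension `d`. -/
structure ResNet (din dout : ℕ) where
  L : ℕ
  w : ℕ
  d : ℕ
  Win : Matrix (Fin d) (Fin din) ℝ
  W : Fin L → Matrix (Fin d) (Fin w) ℝ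
  V : Fin L → Matrix (Fin w) (Fin (d + 1)) ℝ
  Wout : Matrix (Fin dout) (Fin (d + 1)) ℝ

namespace ResNet

variable {din dout : ℕ}

/-- One residual block (0-based index `ℓ`): `z ↦ z + W_ℓ σ(V_ℓ z)` on the first `d`
coordinates, the last coordinate staying fixed to `1`. -/
def step (T : ResNet din dout) (ℓ : Fin T.L) (z : Fin (T.d + 1) → ℝ) :
    Fin (T.d + 1) → ℝ := fun i =>
  if h : i.1 < T.d then
    z i + (T.W ℓ).mulVec (fun j => max ((T.V ℓ).mulVec z j) 0) ⟨i.1, h⟩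
  else 1

/-- The activation `α_ℓ(x)` (blocks `0, …, ℓ-1` applied to `α_0(x)`). -/
def act (T : ResNet din dout) (x : Fin din → ℝ) : ℕ → Fin (T.d + 1) → ℝ
  | 0 => fun i => if h : i.1 < T.d then T.Win.mulVec x ⟨i.1, h⟩ else 1
  | (ℓ + 1) => if h : ℓ < T.L then T.step ⟨ℓ, h⟩ (T.act x ℓ) else T.act x ℓ

/-- The map from the activation `α_ℓ` to the final activation `α_L` (applying blocks
`ℓ, ℓ+1, …, L-1`). -/
def tailAct (T : ResNet din dout) (ℓ : ℕ) (z : Fin (T.d + 1) → ℝ) : Fin (T.d + 1) → ℝ :=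
  if h : ℓ < T.L then T.tailAct (ℓ + 1) (T.step ⟨ℓ, h⟩ z) else z
termination_by T.L - ℓ

/-- The function computed by the ResNet. -/
def fn (T : ResNet din dout) (x : Fin din → ℝ) : Fin dout → ℝ :=
  T.Wout.mulVec (T.act x T.L)

/-- `C_ℓ,ii = sup_x |α_{ℓ,i}(x)|` over the input hyper-rectangle. -/
def Csup (T : ResNet din dout) (a s : Fin din → ℝ) (ℓ : ℕ) (i : Fin (T.d + 1)) : ℝ :=
  sSup {v : ℝ | ∃ x ∈ hyperRect a s, v = |T.act x ℓ i|}

end ResNet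

/-- `g` is `c`-Lipschitz (Euclidean norms). -/
def LipWith {m n : ℕ} (c : ℝ) (g : (Fin m → ℝ) → Fin n → ℝ) : Prop :=
  ∀ z z', euclNorm (fun o => g z o - g z' o) ≤ c * euclNorm (fun i => z i - z' i)

namespace ResNet

variable {din dout : ℕ}

/-- The values `∑_ℓ ‖D_ℓ|W_ℓ||V_ℓ|C_{ℓ-1}‖₁^{2/3} + ‖D_0 W_in S‖₁^{2/3} + ‖W_out C_L‖₁^{2/3}`
over all admissible positive diagonal matrices `D_0, …, D_L` (the map from `α_ℓ` to the
output precomposed with `D_ℓ⁻¹` must be 1-Lipschitz). -/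
def costSet (T : ResNet din dout) (a s : Fin din → ℝ) : Set ℝ :=
  {v | ∃ D : ℕ → Fin (T.d + 1) → ℝ,
    (∀ ℓ i, 0 < D ℓ i) ∧
    (∀ ℓ, ℓ ≤ T.L →
      LipWith 1 (fun z => T.Wout.mulVec (T.tailAct ℓ (fun i => (D ℓ i)⁻¹ * z i)))) ∧
    v = (∑ ℓ : Fin T.L,
          (∑ i : Fin T.d, ∑ j : Fin (T.d + 1),
            D (ℓ.1 + 1) i.castSucc * (∑ k : Fin T.w, |T.W ℓ i k| * |T.V ℓ k j|) *
              T.Csup a s ℓ.1 j) ^ (2/3 : ℝ))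
        + (∑ i : Fin T.d, ∑ j : Fin din, D 0 i.castSucc * |T.Win i j| * s j) ^ (2/3 : ℝ)
        + (∑ o : Fin dout, ∑ j : Fin (T.d + 1), |T.Wout o j| * T.Csup a s T.L j) ^ (2/3 : ℝ)}

/-- The parameter complexity `R(θ)`, with `R(θ)^{2/3}` the minimum of `costSet`. -/
def cost (T : ResNet din dout) (a s : Fin din → ℝ) : ℝ :=
  (sInf (T.costSet a s)) ^ (3/2 : ℝ)

end ResNet

/-- Complexities `R(θ)` of ResNets `ε`-approximating `f` in the norm `N`. -/
def RApproxSet {din dout : ℕ} (a s : Fin din → ℝ)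
    (N : ((Fin din → ℝ) → Fin dout → ℝ) → ℝ)
    (f : (Fin din → ℝ) → Fin dout → ℝ) (ε : ℝ) : Set ℝ :=
  {r | ∃ T : ResNet din dout, N (fun x o => T.fn x o - f x o) ≤ ε ∧ r = T.cost a s}

/-- Values whose supremum is `‖f‖^ω` for the ResNet norm. -/
def RNormSet {din dout : ℕ} (a s : Fin din → ℝ) (ω : ℝ)
    (N : ((Fin din → ℝ) → Fin dout → ℝ) → ℝ)
    (f : (Fin din → ℝ) → Fin dout → ℝ) : Set ℝ :=
  {v | ∃ ε : ℝ, 0 < ε ∧ v = ε ^ (ω - 1) * sInf (RApproxSet a s N f ε)}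

/-- The ResNet norm `‖f‖_{R^ω(N)} = (sup_{ε>0} ε^{ω-1} inf{R(θ) : ‖f_θ - f‖ ≤ ε})^{1/ω}`. -/
def RNorm {din dout : ℕ} (a s : Fin din → ℝ) (ω : ℝ)
    (N : ((Fin din → ℝ) → Fin dout → ℝ) → ℝ)
    (f : (Fin din → ℝ) → Fin dout → ℝ) : ℝ :=
  (sSup (RNormSet a s ω N f)) ^ ω⁻¹

/-- Finiteness of the ResNet norm. -/
def RNormFin {din dout : ℕ} (a s : Fin din → ℝ) (ω : ℝ)
    (N : ((Fin din → ℝ) → Fin dout → ℝ) → ℝ)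
    (f : (Fin din → ℝ) → Fin dout → ℝ) : Prop :=
  (∀ ε : ℝ, 0 < ε → (RApproxSet a s N f ε).Nonempty) ∧ BddAbove (RNormSet a s ω N f)

/-! ## Tetrakis extension -/

/-- The Tetrakis (mirrored Kuhn) extension `TK_M[C] : [0,1]^{d_in} → [0,1]^{d_out}` of the
values of a circuit `C` on the `2^M`-point grid: `x` is rescaled to integer grid
coordinates, the simplex containing it is found by sorting the distances to the even
endpoints of its cell, and the circuit values at the `d_in + 1` vertices of this simplex
are combined with the barycentric weights of `x`. -/
def TK {din dout : ℕ} (M Mout : ℕ) (C : Circuit (din * M) (dout * Mout))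
    (x : Fin din → ℝ) (o : Fin dout) : ℝ :=
  let z : Fin din → ℝ := fun i => x i * (2 ^ M - 1)
  let n : Fin din → ℕ := fun i => min ⌊z i⌋₊ (2 ^ M - 2)
  let e : Fin din → ℕ := fun i => if n i % 2 = 0 then n i else n i + 1
  let od : Fin din → ℕ := fun i => if n i % 2 = 0 then n i + 1 else n i
  let sc : Fin din → ℝ := fun i => |z i - (e i : ℝ)|
  let σ : Equiv.Perm (Fin din) := Tuple.sort sc
  let t : ℕ → ℝ := fun k =>
    if h0 : k = 0 then 0 else if h : k ≤ din then sc (σ ⟨k - 1, by omega⟩) else 1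
  let vtx : ℕ → Fin din → ℕ := fun k i => if k < (σ.symm i).1 + 1 then e i else od i
  ∑ k ∈ Finset.range (din + 1),
    (t (k + 1) - t k) *
      ∑ m : Fin Mout,
        ((2 : ℝ) ^ (m.1 + 1))⁻¹ *
          (if C.eval
              (fun idx => Nat.testBit (vtx k ((finProdFinEquiv.symm idx).1))
                ((finProdFinEquiv.symm idx).2 : Fin M).1)
              (finProdFinEquiv (o, m)) then 1 else 0)


/-- Lower corner of the unit cube. -/
def cubeA (d : ℕ) : Fin d → ℝ := fun _ => 0

/-- Side lengths of the unit cube. -/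
def cubeS (d : ℕ) : Fin d → ℝ := fun _ => 1

end

noncomputable section

theorem euclNorm_eq_norm {d : ℕ} (v : Fin d → ℝ) : euclNorm v = ‖WithLp.toLp 2 v‖ := by
  simp [euclNorm, EuclideanSpace.norm_eq]

theorem euclNorm_add_le {d : ℕ} (u v : Fin d → ℝ) :
    euclNorm (fun i => u i + v i) ≤ euclNorm u + euclNorm v := by
  simp only [euclNorm_eq_norm]
  exact norm_add_le (WithLp.toLp 2 u) (WithLp.toLp 2 v)

theorem euclNorm_nonneg {d : ℕ} (v : Fin d → ℝ) : 0 ≤ euclNorm v := Real.sqrt_nonneg _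

theorem euclNorm_sq {d : ℕ} (v : Fin d → ℝ) : euclNorm v ^ 2 = ∑ i, v i ^ 2 :=
  Real.sq_sqrt (Finset.sum_nonneg fun i _ => sq_nonneg (v i))

theorem LipschitzWith.exists_lipWith {m n : ℕ} {K : NNReal} {g : (Fin m → ℝ) → Fin n → ℝ}
    (hg : LipschitzWith K g) : ∃ c : ℝ, 0 < c ∧ LipWith c g := by
  have h1 := PiLp.lipschitzWith_toLp 2 (fun _ : Fin n => ℝ)
  have h2 := PiLp.lipschitzWith_ofLp 2 (fun _ : Fin m => ℝ)
  have h := (h1.comp hg).comp h2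
  generalize _ * K * 1 = C at h
  refine ⟨C + 1, add_pos_of_nonneg_of_pos C.coe_nonneg one_pos, fun z z' => ?_⟩
  have := h.dist_le_mul (WithLp.toLp 2 z) (WithLp.toLp 2 z')
  rw [dist_eq_norm, dist_eq_norm] at this
  rw [euclNorm_eq_norm, euclNorm_eq_norm]
  refine le_trans this ?_
  exact mul_le_mul_of_nonneg_right (le_add_of_nonneg_right zero_le_one) (norm_nonneg _)

/-- Overwrite the last coordinate by `1`. -/
def setLastOne {d : ℕ} (z : Fin (d + 1) → ℝ) : Fin (d + 1) → ℝ :=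
  Fin.snoc (α := fun _ => ℝ) (fun i => z i.castSucc) 1

theorem setLastOne_of_last {d : ℕ} {z : Fin (d + 1) → ℝ} (hz : z (Fin.last d) = 1) :
    setLastOne z = z := by
  ext i
  refine Fin.lastCases ?_ (fun i => ?_) i <;> simp [setLastOne, hz]

namespace ResNet

variable {din dout : ℕ}

/-- The weights `W_ℓ`, extended by zero beyond the depth. -/
def outer (T : ResNet din dout) (ℓ : ℕ) : Matrix (Fin T.d) (Fin T.w) ℝ :=
  if h : ℓ < T.L then T.W ⟨ℓ, h⟩ else 0

/-- The weights `V_ℓ`, extended by zero beyond the depth. -/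
def inner (T : ResNet din dout) (ℓ : ℕ) : Matrix (Fin T.w) (Fin (T.d + 1)) ℝ :=
  if h : ℓ < T.L then T.V ⟨ℓ, h⟩ else 0

/-- The residual block built from `outer` and `inner`. -/
def block (T : ResNet din dout) (ℓ : ℕ) (z : Fin (T.d + 1) → ℝ) : Fin (T.d + 1) → ℝ :=
  Fin.snoc (α := fun _ => ℝ)
    (fun i => z i.castSucc +
      (T.outer ℓ).mulVec (fun j => max ((T.inner ℓ).mulVec z j) 0) i) 1

/-- Apply the blocks `ℓ, …, ℓ + n - 1`. -/
def blocks (T : ResNet din dout) (ℓ : ℕ) : ℕ → (Fin (T.d + 1) → ℝ) → Fin (T.d + 1) → ℝ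
  | 0 => id
  | n + 1 => fun z => T.block (ℓ + n) (T.blocks ℓ n z)

variable (T : ResNet din dout)

theorem block_last (ℓ : ℕ) (z : Fin (T.d + 1) → ℝ) : T.block ℓ z (Fin.last _) = 1 := by
  simp [block]

theorem block_castSucc (ℓ : ℕ) (z : Fin (T.d + 1) → ℝ) (i : Fin T.d) :
    T.block ℓ z i.castSucc = z i.castSucc +
      ∑ k, T.outer ℓ i k * max (∑ j, T.inner ℓ k j * z j) 0 := by
  simp [block, Matrix.mulVec, dotProduct]

theorem block_of_ge {ℓ : ℕ} (h : T.L ≤ ℓ) (z : Fin (T.d + 1) → ℝ) :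
    T.block ℓ z = setLastOne z := by
  simp [block, outer, setLastOne, h.not_gt]

theorem step_eq_block (ℓ : Fin T.L) (z : Fin (T.d + 1) → ℝ) : T.step ℓ z = T.block ℓ z := by
  ext i
  refine Fin.lastCases ?_ (fun i => ?_) i <;> simp [step, block, outer, inner]

theorem blocks_succ' (ℓ n : ℕ) (z : Fin (T.d + 1) → ℝ) :
    T.blocks ℓ (n + 1) z = T.blocks (ℓ + 1) n (T.block ℓ z) := by
  induction n with
  | zero => rfl
  | succ n ih =>
    change T.block (ℓ + (n + 1)) (T.blocks ℓ (n + 1) z) = T.block (ℓ + 1 + n) _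
    rw [ih]
    congr 1
    omega

theorem blocks_succ_last (ℓ n : ℕ) (z : Fin (T.d + 1) → ℝ) :
    T.blocks ℓ (n + 1) z (Fin.last _) = 1 :=
  T.block_last _ _

theorem tailAct_of_ge {ℓ : ℕ} (h : T.L ≤ ℓ) (z : Fin (T.d + 1) → ℝ) : T.tailAct ℓ z = z := by
  rw [tailAct, dif_neg (by omega)]

theorem tailAct_eq_blocks (ℓ n : ℕ) (h : ℓ + n = T.L) (z : Fin (T.d + 1) → ℝ) :
    T.tailAct ℓ z = T.blocks ℓ n z := by
  induction n generalizing ℓ z with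
  | zero => exact T.tailAct_of_ge (by omega) z
  | succ n ih =>
    rw [tailAct, dif_pos (by omega), ih _ (by omega), blocks_succ', step_eq_block]

theorem blocks_of_lt {ℓ n : ℕ} (hℓ : ℓ < T.L) (hn : T.L ≤ ℓ + n) (z : Fin (T.d + 1) → ℝ) :
    T.blocks ℓ n z = T.tailAct ℓ z := by
  obtain ⟨k, rfl⟩ : ∃ k, n = (T.L - ℓ) + k := ⟨n - (T.L - ℓ), by omega⟩
  induction k with
  | zero => exact (T.tailAct_eq_blocks _ _ (by omega) z).symm
  | succ k ih =>
    rw [← ih (by omega)]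
    change T.block (ℓ + (T.L - ℓ + k)) (T.blocks ℓ (T.L - ℓ + k) z) = _
    rw [T.block_of_ge (by omega), setLastOne_of_last]
    obtain ⟨m, hm⟩ : ∃ m, T.L - ℓ + k = m + 1 := ⟨T.L - ℓ + k - 1, by omega⟩
    rw [hm, blocks_succ_last]

theorem blocks_succ_of_ge {ℓ : ℕ} (hℓ : T.L ≤ ℓ) (n : ℕ) (z : Fin (T.d + 1) → ℝ) :
    T.blocks ℓ (n + 1) z = setLastOne z := by
  induction n with
  | zero => exact T.block_of_ge hℓ z
  | succ n ih =>
    change T.block _ (T.blocks ℓ (n + 1) z) = _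
    rw [T.block_of_ge (by omega), ih, setLastOne_of_last]
    simp [setLastOne]

theorem act_zero_castSucc (x : Fin din → ℝ) (i : Fin T.d) :
    T.act x 0 i.castSucc = ∑ j, T.Win i j * x j := by
  simp [act, Matrix.mulVec, dotProduct]

theorem act_last (x : Fin din → ℝ) (ℓ : ℕ) : T.act x ℓ (Fin.last _) = 1 := by
  induction ℓ with
  | zero => simp [act]
  | succ ℓ ih =>
    rw [act]
    split_ifs
    · simp [step]
    · exact ih

theorem act_succ (x : Fin din → ℝ) (ℓ : ℕ) : T.act x (ℓ + 1) = T.block ℓ (T.act x ℓ) := by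
  rw [act]
  split_ifs with h
  · exact T.step_eq_block _ _
  · rw [T.block_of_ge (by omega), setLastOne_of_last (T.act_last x ℓ)]

theorem act_of_ge (x : Fin din → ℝ) {ℓ : ℕ} (h : T.L ≤ ℓ) : T.act x ℓ = T.act x T.L := by
  induction ℓ, h using Nat.le_induction with
  | base => rfl
  | succ n hn ih => rw [act, dif_neg (by omega), ih]

/-- A diagonal rescaling for which the rest of the network is `1`-Lipschitz at every layer. -/
def Admissible (D : ℕ → Fin (T.d + 1) → ℝ) : Prop :=
  (∀ ℓ i, 0 < D ℓ i) ∧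
    ∀ ℓ, ℓ ≤ T.L → LipWith 1 (fun z => T.Wout.mulVec (T.tailAct ℓ (fun i => (D ℓ i)⁻¹ * z i)))

variable {T}

theorem Admissible.lipWith_blocks {D : ℕ → Fin (T.d + 1) → ℝ} (hD : T.Admissible D)
    {ℓ n : ℕ} (hn : T.L ≤ ℓ + n) :
    LipWith 1 (fun z => T.Wout.mulVec
      (T.blocks ℓ n (fun i => (D (min ℓ T.L) i)⁻¹ * z i))) := by
  rcases lt_or_ge ℓ T.L with hℓ | hℓ
  · simp only [T.blocks_of_lt hℓ hn, min_eq_left hℓ.le]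
    exact hD.2 ℓ hℓ.le
  · have hlip := hD.2 T.L le_rfl
    simp only [T.tailAct_of_ge le_rfl] at hlip
    rw [min_eq_right hℓ]
    cases n with
    | zero => exact hlip
    | succ n =>
      simp only [T.blocks_succ_of_ge hℓ]
      have hset : ∀ z : Fin (T.d + 1) → ℝ, setLastOne (fun i => (D T.L i)⁻¹ * z i) =
          fun i => (D T.L i)⁻¹ * (Fin.snoc (α := fun _ => ℝ) (fun j => z j.castSucc)
            (D T.L (Fin.last _)) : Fin (T.d + 1) → ℝ) i := by
        intro z
        ext i
        refine Fin.lastCases ?_ (fun i => ?_) i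
        · simp [setLastOne, (hD.1 T.L (Fin.last _)).ne']
        · simp [setLastOne]
      intro z z'
      simp only [hset]
      refine (hlip _ _).trans ?_
      rw [one_mul, one_mul]
      refine Real.sqrt_le_sqrt ?_
      simp only [Fin.sum_univ_castSucc, Fin.snoc_castSucc, Fin.snoc_last, sub_self]
      nlinarith [sq_nonneg (z (Fin.last _) - z' (Fin.last _))]

variable (T)

theorem exists_lipschitzWith_block (ℓ : ℕ) : ∃ K, LipschitzWith K (T.block ℓ) := by
  have hV := (Matrix.mulVecLin (T.inner ℓ)).toContinuousLinearMap.lipschitz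
  have hW := (Matrix.mulVecLin (T.outer ℓ)).toContinuousLinearMap.lipschitz
  have hmax : LipschitzWith 1 (fun (u : Fin T.w → ℝ) j => max (u j) 0) := by
    refine LipschitzWith.of_dist_le_mul fun u v => ?_
    rw [NNReal.coe_one, one_mul, dist_pi_le_iff dist_nonneg]
    intro j
    refine le_trans ?_ (dist_le_pi_dist u v j)
    rw [Real.dist_eq, Real.dist_eq]
    exact abs_max_sub_max_le_abs _ _ _
  have hinit : LipschitzWith 1 (fun (z : Fin (T.d + 1) → ℝ) (i : Fin T.d) => z i.castSucc) := by
    refine LipschitzWith.of_dist_le_mul fun u v => ?_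
    rw [NNReal.coe_one, one_mul, dist_pi_le_iff dist_nonneg]
    exact fun i => dist_le_pi_dist u v _
  have hsnoc : LipschitzWith 1 (fun (u : Fin T.d → ℝ) =>
      (Fin.snoc (α := fun _ => ℝ) u 1 : Fin (T.d + 1) → ℝ)) := by
    refine LipschitzWith.of_dist_le_mul fun u v => ?_
    rw [NNReal.coe_one, one_mul, dist_pi_le_iff dist_nonneg]
    intro i
    refine Fin.lastCases ?_ (fun i => ?_) i
    · simp
    · simpa using dist_le_pi_dist u v i
  exact ⟨_, hsnoc.comp (hinit.add (hW.comp (hmax.comp hV)))⟩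

theorem exists_lipschitzWith_blocks (ℓ n : ℕ) : ∃ K, LipschitzWith K (T.blocks ℓ n) := by
  induction n with
  | zero => exact ⟨1, LipschitzWith.id⟩
  | succ n ih =>
    obtain ⟨K, hK⟩ := ih
    obtain ⟨K', hK'⟩ := T.exists_lipschitzWith_block (ℓ + n)
    exact ⟨_, hK'.comp hK⟩

theorem exists_admissible : ∃ D, T.Admissible D := by
  have h : ∀ ℓ, ∃ c : ℝ, 0 < c ∧
      LipWith c (fun z => T.Wout.mulVec (T.blocks ℓ (T.L - ℓ) z)) := fun ℓ => by
    obtain ⟨K, hK⟩ := T.exists_lipschitzWith_blocks ℓ (T.L - ℓ)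
    exact ((Matrix.mulVecLin T.Wout).toContinuousLinearMap.lipschitz.comp hK).exists_lipWith
  choose c hc hlip using h
  refine ⟨fun ℓ _ => c ℓ, fun ℓ _ => hc ℓ, fun ℓ hℓ z z' => ?_⟩
  simp only [T.tailAct_eq_blocks ℓ (T.L - ℓ) (by omega)]
  refine (hlip ℓ _ _).trans (le_of_eq ?_)
  have : euclNorm (fun i => (c ℓ)⁻¹ * z i - (c ℓ)⁻¹ * z' i) =
      (c ℓ)⁻¹ * euclNorm (fun i => z i - z' i) := by
    simp only [← mul_sub, euclNorm, mul_pow, ← Finset.mul_sum]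
    rw [Real.sqrt_mul (sq_nonneg _), Real.sqrt_sq (inv_nonneg.2 (hc ℓ).le)]
  rw [this, mul_inv_cancel_left₀ (hc ℓ).ne', one_mul]

/-! ### Concatenation of hidden coordinates -/

/-- Join two vectors of hidden coordinates, with prescribed last coordinate. -/
def join {m n : ℕ} (u : Fin m → ℝ) (v : Fin n → ℝ) (t : ℝ) : Fin (m + n + 1) → ℝ :=
  Fin.snoc (α := fun _ => ℝ) (Fin.append u v) t

/-- Restriction to the first group of hidden coordinates and the last coordinate. -/
def restrictLeft {m n : ℕ} (z : Fin (m + n + 1) → ℝ) : Fin (m + 1) → ℝ :=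
  Fin.snoc (α := fun _ => ℝ) (fun i => z (Fin.castAdd n i).castSucc) (z (Fin.last _))

/-- Restriction to the second group of hidden coordinates and the last coordinate. -/
def restrictRight {m n : ℕ} (z : Fin (m + n + 1) → ℝ) : Fin (n + 1) → ℝ :=
  Fin.snoc (α := fun _ => ℝ) (fun i => z (Fin.natAdd m i).castSucc) (z (Fin.last _))

/-- Extension by zero of a row acting on the first group of hidden coordinates. -/
def extendLeft {m : ℕ} (n : ℕ) (r : Fin (m + 1) → ℝ) : Fin (m + n + 1) → ℝ :=
  join (fun i => r i.castSucc) (fun _ => 0) (r (Fin.last _))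

/-- Extension by zero of a row acting on the second group of hidden coordinates. -/
def extendRight (m : ℕ) {n : ℕ} (r : Fin (n + 1) → ℝ) : Fin (m + n + 1) → ℝ :=
  join (fun _ => 0) (fun i => r i.castSucc) (r (Fin.last _))

section join

variable {m n : ℕ} (u : Fin m → ℝ) (v : Fin n → ℝ) (t : ℝ)

@[simp] theorem join_left (i : Fin m) : join u v t (Fin.castAdd n i).castSucc = u i := by
  simp [join]

@[simp] theorem join_right (i : Fin n) : join u v t (Fin.natAdd m i).castSucc = v i := by
  simp [join, -Fin.castSucc_natAdd]

@[simp] theorem join_last : join u v t (Fin.last _) = t := by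
  simp [join]

theorem sum_hidden (F : Fin (m + n + 1) → ℝ) :
    ∑ j, F j = ∑ i : Fin m, F (Fin.castAdd n i).castSucc +
      ∑ i : Fin n, F (Fin.natAdd m i).castSucc + F (Fin.last _) := by
  rw [Fin.sum_univ_castSucc, Fin.sum_univ_add]

theorem forall_hidden {P : Fin (m + n + 1) → Prop} (hl : ∀ i, P (Fin.castAdd n i).castSucc)
    (hr : ∀ i, P (Fin.natAdd m i).castSucc) (h : P (Fin.last _)) (i) : P i :=
  Fin.lastCases h (fun i => Fin.addCases hl hr i) i

theorem sum_extendLeft_mul (r : Fin (m + 1) → ℝ) (z : Fin (m + n + 1) → ℝ) :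
    ∑ j, extendLeft n r j * z j = ∑ j, r j * restrictLeft z j := by
  rw [sum_hidden, Fin.sum_univ_castSucc]
  simp [extendLeft, restrictLeft, -Fin.castSucc_natAdd]

theorem sum_extendRight_mul (r : Fin (n + 1) → ℝ) (z : Fin (m + n + 1) → ℝ) :
    ∑ j, extendRight m r j * z j = ∑ j, r j * restrictRight z j := by
  rw [sum_hidden, Fin.sum_univ_castSucc]
  simp [extendRight, restrictRight, -Fin.castSucc_natAdd]

theorem abs_extendLeft (r : Fin (m + 1) → ℝ) (j) :
    |extendLeft n r j| = extendLeft n (fun i => |r i|) j := by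
  revert j
  refine forall_hidden (fun i => ?_) (fun i => ?_) ?_ <;> simp [extendLeft, -Fin.castSucc_natAdd]

theorem abs_extendRight (r : Fin (n + 1) → ℝ) (j) :
    |extendRight m r j| = extendRight m (fun i => |r i|) j := by
  revert j
  refine forall_hidden (fun i => ?_) (fun i => ?_) ?_ <;> simp [extendRight, -Fin.castSucc_natAdd]

end join

/-! ### The parallel sum of two networks -/

/-- The network running `T₁` and `T₂` in parallel and adding their outputs. -/
abbrev parallel (T₁ T₂ : ResNet din dout) : ResNet din dout where
  L := max T₁.L T₂.L
  w := T₁.w + T₂.w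
  d := T₁.d + T₂.d
  Win i j := Fin.append (fun i => T₁.Win i j) (fun i => T₂.Win i j) i
  W ℓ := Fin.append (fun i => Fin.append (T₁.outer ℓ i) 0) (fun i => Fin.append 0 (T₂.outer ℓ i))
  V ℓ := Fin.append (fun k => extendLeft T₂.d (T₁.inner ℓ k))
    (fun k => extendRight T₁.d (T₂.inner ℓ k))
  Wout o j := extendLeft T₂.d (T₁.Wout o) j + extendRight T₁.d (T₂.Wout o) j

section parallel

variable (T₁ T₂ : ResNet din dout)

theorem parallel_outer (ℓ : ℕ) : (T₁.parallel T₂).outer ℓ =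
    Fin.append (fun i => Fin.append (T₁.outer ℓ i) 0)
      (fun i => Fin.append 0 (T₂.outer ℓ i)) := by
  by_cases h : ℓ < (T₁.parallel T₂).L
  · rw [outer, dif_pos h]
  · rw [outer, dif_neg h]
    have h' : ¬ ℓ < max T₁.L T₂.L := h
    rw [lt_max_iff, not_or] at h'
    ext i j
    refine Fin.addCases (fun i => ?_) (fun i => ?_) i <;>
      refine Fin.addCases (fun j => ?_) (fun j => ?_) j <;>
        simp [outer, h'.1, h'.2]

theorem parallel_inner (ℓ : ℕ) : (T₁.parallel T₂).inner ℓ =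
    Fin.append (fun k => extendLeft T₂.d (T₁.inner ℓ k))
      (fun k => extendRight T₁.d (T₂.inner ℓ k)) := by
  by_cases h : ℓ < (T₁.parallel T₂).L
  · rw [inner, dif_pos h]
  · rw [inner, dif_neg h]
    have h' : ¬ ℓ < max T₁.L T₂.L := h
    rw [lt_max_iff, not_or] at h'
    ext k j
    refine Fin.addCases (fun k => ?_) (fun k => ?_) k <;>
      revert j <;> refine forall_hidden (fun i => ?_) (fun i => ?_) ?_ <;>
        simp [inner, h'.1, h'.2, extendLeft, extendRight, -Fin.castSucc_natAdd]

theorem restrictLeft_block (ℓ : ℕ) (z : Fin (T₁.d + T₂.d + 1) → ℝ) :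
    restrictLeft ((T₁.parallel T₂).block ℓ z : Fin (T₁.d + T₂.d + 1) → ℝ) =
      T₁.block ℓ (restrictLeft z) := by
  have hlast := (T₁.parallel T₂).block_last ℓ z
  ext i
  refine Fin.lastCases ?_ (fun i => ?_) i
  · rw [block_last]
    exact (Fin.snoc_last (α := fun _ => ℝ) _ _).trans hlast
  · refine (Fin.snoc_castSucc (α := fun _ => ℝ) _ _ _).trans ?_
    rw [block_castSucc T₁]
    refine (block_castSucc (T₁.parallel T₂) ℓ z (Fin.castAdd T₂.d i)).trans ?_
    rw [parallel_outer, parallel_inner]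
    refine congrArg₂ _ (by simp [restrictLeft, -Fin.castSucc_natAdd]) ?_
    refine (Fin.sum_univ_add _).trans ?_
    simp [sum_extendLeft_mul, restrictLeft, -Fin.castSucc_natAdd]

theorem restrictRight_block (ℓ : ℕ) (z : Fin (T₁.d + T₂.d + 1) → ℝ) :
    restrictRight ((T₁.parallel T₂).block ℓ z : Fin (T₁.d + T₂.d + 1) → ℝ) =
      T₂.block ℓ (restrictRight z) := by
  have hlast := (T₁.parallel T₂).block_last ℓ z
  ext i
  refine Fin.lastCases ?_ (fun i => ?_) i
  · rw [block_last]
    exact (Fin.snoc_last (α := fun _ => ℝ) _ _).trans hlast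
  · refine (Fin.snoc_castSucc (α := fun _ => ℝ) _ _ _).trans ?_
    rw [block_castSucc T₂]
    refine (block_castSucc (T₁.parallel T₂) ℓ z (Fin.natAdd T₁.d i)).trans ?_
    rw [parallel_outer, parallel_inner]
    refine congrArg₂ _ (by simp [restrictRight, -Fin.castSucc_natAdd]) ?_
    refine (Fin.sum_univ_add _).trans ?_
    simp [sum_extendRight_mul, restrictRight, -Fin.castSucc_natAdd]

theorem restrictLeft_blocks (ℓ n : ℕ) (z : Fin (T₁.d + T₂.d + 1) → ℝ) :
    restrictLeft ((T₁.parallel T₂).blocks ℓ n z : Fin (T₁.d + T₂.d + 1) → ℝ) =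
      T₁.blocks ℓ n (restrictLeft z) := by
  induction n with
  | zero => rfl
  | succ n ih => exact (restrictLeft_block T₁ T₂ _ _).trans (congrArg _ ih)

theorem restrictRight_blocks (ℓ n : ℕ) (z : Fin (T₁.d + T₂.d + 1) → ℝ) :
    restrictRight ((T₁.parallel T₂).blocks ℓ n z : Fin (T₁.d + T₂.d + 1) → ℝ) =
      T₂.blocks ℓ n (restrictRight z) := by
  induction n with
  | zero => rfl
  | succ n ih => exact (restrictRight_block T₁ T₂ _ _).trans (congrArg _ ih)

theorem restrictLeft_act (x : Fin din → ℝ) (ℓ : ℕ) :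
    restrictLeft ((T₁.parallel T₂).act x ℓ : Fin (T₁.d + T₂.d + 1) → ℝ) = T₁.act x ℓ := by
  induction ℓ with
  | zero =>
    have hlast := (T₁.parallel T₂).act_last x 0
    ext i
    refine Fin.lastCases ?_ (fun i => ?_) i
    · rw [act_last]
      exact (Fin.snoc_last (α := fun _ => ℝ) _ _).trans hlast
    · refine (Fin.snoc_castSucc (α := fun _ => ℝ) _ _ _).trans ?_
      rw [T₁.act_zero_castSucc]
      refine ((T₁.parallel T₂).act_zero_castSucc x (Fin.castAdd T₂.d i)).trans ?_
      simp
  | succ ℓ ih =>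
    rw [act_succ, act_succ, ← ih]
    exact restrictLeft_block T₁ T₂ ℓ _

theorem restrictRight_act (x : Fin din → ℝ) (ℓ : ℕ) :
    restrictRight ((T₁.parallel T₂).act x ℓ : Fin (T₁.d + T₂.d + 1) → ℝ) = T₂.act x ℓ := by
  induction ℓ with
  | zero =>
    have hlast := (T₁.parallel T₂).act_last x 0
    ext i
    refine Fin.lastCases ?_ (fun i => ?_) i
    · rw [act_last]
      exact (Fin.snoc_last (α := fun _ => ℝ) _ _).trans hlast
    · refine (Fin.snoc_castSucc (α := fun _ => ℝ) _ _ _).trans ?_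
      rw [T₂.act_zero_castSucc]
      refine ((T₁.parallel T₂).act_zero_castSucc x (Fin.natAdd T₁.d i)).trans ?_
      simp
  | succ ℓ ih =>
    rw [act_succ, act_succ, ← ih]
    exact restrictRight_block T₁ T₂ ℓ _

theorem parallel_Wout_mulVec (z : Fin (T₁.d + T₂.d + 1) → ℝ) (o : Fin dout) :
    (T₁.parallel T₂).Wout.mulVec z o =
      T₁.Wout.mulVec (restrictLeft z) o + T₂.Wout.mulVec (restrictRight z) o := by
  change ∑ j, (extendLeft T₂.d (T₁.Wout o) j + extendRight T₁.d (T₂.Wout o) j) * z j = _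
  simp only [add_mul, Finset.sum_add_distrib, sum_extendLeft_mul, sum_extendRight_mul]
  rfl

theorem parallel_fn (x : Fin din → ℝ) (o : Fin dout) :
    (T₁.parallel T₂).fn x o = T₁.fn x o + T₂.fn x o := by
  rw [fn, parallel_Wout_mulVec, restrictLeft_act, restrictRight_act,
    T₁.act_of_ge x (le_max_left T₁.L T₂.L : T₁.L ≤ (T₁.parallel T₂).L),
    T₂.act_of_ge x (le_max_right T₁.L T₂.L : T₂.L ≤ (T₁.parallel T₂).L)]
  rfl

theorem restrictLeft_Csup (a s : Fin din → ℝ) (ℓ : ℕ) :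
    restrictLeft ((T₁.parallel T₂).Csup a s ℓ : Fin (T₁.d + T₂.d + 1) → ℝ) =
      T₁.Csup a s ℓ := by
  ext i
  simp only [Csup, ← restrictLeft_act T₁ T₂]
  refine Fin.lastCases ?_ (fun i => ?_) i <;> simp [restrictLeft, Csup, -Fin.castSucc_natAdd]

theorem restrictRight_Csup (a s : Fin din → ℝ) (ℓ : ℕ) :
    restrictRight ((T₁.parallel T₂).Csup a s ℓ : Fin (T₁.d + T₂.d + 1) → ℝ) =
      T₂.Csup a s ℓ := by
  ext i
  simp only [Csup, ← restrictRight_act T₁ T₂]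
  refine Fin.lastCases ?_ (fun i => ?_) i <;> simp [restrictRight, Csup, -Fin.castSucc_natAdd]

end parallel

/-! ### Costs -/

/-- `‖D|W_ℓ||V_ℓ|C_{ℓ-1}‖₁` for the block `ℓ`. -/
def blockCost (T : ResNet din dout) (a s : Fin din → ℝ) (ℓ : ℕ) (D : Fin (T.d + 1) → ℝ) : ℝ :=
  ∑ i : Fin T.d, ∑ j, D i.castSucc * (∑ k, |T.outer ℓ i k| * |T.inner ℓ k j|) * T.Csup a s ℓ j

/-- `‖D W_in S‖₁`. -/
def inputCost (T : ResNet din dout) (s : Fin din → ℝ) (D : Fin (T.d + 1) → ℝ) : ℝ :=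
  ∑ i : Fin T.d, ∑ j : Fin din, D i.castSucc * |T.Win i j| * s j

/-- `‖W_out C_L‖₁`. -/
def outputCost (T : ResNet din dout) (a s : Fin din → ℝ) : ℝ :=
  ∑ o : Fin dout, ∑ j, |T.Wout o j| * T.Csup a s T.L j

/-- The terms of the complexity indexed by the scalings `D_0, D_1, …`, the input term first. -/
def stageCost (T : ResNet din dout) (a s : Fin din → ℝ) : ℕ → (Fin (T.d + 1) → ℝ) → ℝ
  | 0 => T.inputCost s
  | ℓ + 1 => T.blockCost a s ℓ

theorem blockCost_eq (a s : Fin din → ℝ) (ℓ : ℕ) (D : Fin (T.d + 1) → ℝ) :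
    T.blockCost a s ℓ D = ∑ i : Fin T.d, D i.castSucc *
      ∑ k, |T.outer ℓ i k| * ∑ j, |T.inner ℓ k j| * T.Csup a s ℓ j := by
  refine Finset.sum_congr rfl fun i _ => ?_
  simp only [Finset.mul_sum, Finset.sum_mul]
  rw [Finset.sum_comm]
  exact Finset.sum_congr rfl fun k _ => Finset.sum_congr rfl fun j _ => by ring

theorem blockCost_of_ge (a s : Fin din → ℝ) {ℓ : ℕ} (h : T.L ≤ ℓ) (D : Fin (T.d + 1) → ℝ) :
    T.blockCost a s ℓ D = 0 := by
  simp [blockCost, outer, h.not_gt]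

theorem Csup_nonneg (a s : Fin din → ℝ) (ℓ : ℕ) (i : Fin (T.d + 1)) : 0 ≤ T.Csup a s ℓ i := by
  refine Real.sSup_nonneg ?_
  rintro _ ⟨x, _, rfl⟩
  exact abs_nonneg _

theorem stageCost_nonneg (a : Fin din → ℝ) {s : Fin din → ℝ} (hs : ∀ i, 0 < s i) (ℓ : ℕ)
    {D : Fin (T.d + 1) → ℝ} (hD : ∀ i, 0 < D i) : 0 ≤ T.stageCost a s ℓ D := by
  cases ℓ with
  | zero =>
    rw [stageCost, inputCost]
    exact Finset.sum_nonneg fun i _ => Finset.sum_nonneg fun j _ =>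
      mul_nonneg (mul_nonneg (hD _).le (abs_nonneg _)) (hs j).le
  | succ ℓ =>
    rw [stageCost, blockCost]
    exact Finset.sum_nonneg fun i _ => Finset.sum_nonneg fun j _ =>
      mul_nonneg (mul_nonneg (hD _).le (Finset.sum_nonneg fun k _ => by positivity))
        (T.Csup_nonneg a s ℓ j)

theorem outputCost_nonneg (a s : Fin din → ℝ) : 0 ≤ T.outputCost a s :=
  Finset.sum_nonneg fun _ _ => Finset.sum_nonneg fun j _ =>
    mul_nonneg (abs_nonneg _) (T.Csup_nonneg a s _ j)

/-- The complexity for fixed scalings, padded with trivial blocks up to depth `n`. -/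
theorem mem_costSet_iff (a s : Fin din → ℝ) {n : ℕ} (hn : T.L ≤ n) {v : ℝ} :
    v ∈ T.costSet a s ↔ ∃ D, T.Admissible D ∧
      v = ∑ ℓ ∈ Finset.range (n + 1), T.stageCost a s ℓ (D (min ℓ T.L)) ^ (2 / 3 : ℝ)
        + T.outputCost a s ^ (2 / 3 : ℝ) := by
  have key : ∀ D : ℕ → Fin (T.d + 1) → ℝ,
      ∑ ℓ ∈ Finset.range n, T.stageCost a s (ℓ + 1) (D (min (ℓ + 1) T.L)) ^ (2 / 3 : ℝ) =
      ∑ ℓ : Fin T.L, (∑ i : Fin T.d, ∑ j : Fin (T.d + 1),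
            D (ℓ.1 + 1) i.castSucc * (∑ k : Fin T.w, |T.W ℓ i k| * |T.V ℓ k j|) *
              T.Csup a s ℓ.1 j) ^ (2 / 3 : ℝ) := by
    intro D
    rw [← Finset.sum_subset (Finset.range_subset_range.2 hn), Finset.sum_range]
    · refine Finset.sum_congr rfl fun ℓ _ => ?_
      simp [stageCost, blockCost, outer, inner]
    · intro ℓ _ hℓ
      rw [stageCost, T.blockCost_of_ge a s (by simpa using hℓ), Real.zero_rpow (by norm_num)]
  constructor
  · rintro ⟨D, h1, h2, rfl⟩
    refine ⟨D, ⟨h1, h2⟩, ?_⟩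
    rw [Finset.sum_range_succ', key, Nat.zero_min]
    rfl
  · rintro ⟨D, ⟨h1, h2⟩, rfl⟩
    refine ⟨D, h1, h2, ?_⟩
    rw [Finset.sum_range_succ', key, Nat.zero_min]
    rfl

theorem costSet_nonneg (a : Fin din → ℝ) {s : Fin din → ℝ} (hs : ∀ i, 0 < s i) {v : ℝ}
    (hv : v ∈ T.costSet a s) : 0 ≤ v := by
  obtain ⟨D, hD, rfl⟩ := (T.mem_costSet_iff a s le_rfl).1 hv
  exact add_nonneg
    (Finset.sum_nonneg fun ℓ _ => Real.rpow_nonneg (T.stageCost_nonneg a hs ℓ (hD.1 _)) _)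
    (Real.rpow_nonneg (T.outputCost_nonneg a s) _)

theorem costSet_nonempty (a s : Fin din → ℝ) : (T.costSet a s).Nonempty := by
  obtain ⟨D, hD⟩ := T.exists_admissible
  exact ⟨_, (T.mem_costSet_iff a s le_rfl).2 ⟨D, hD, rfl⟩⟩

theorem cost_nonneg (a : Fin din → ℝ) {s : Fin din → ℝ} (hs : ∀ i, 0 < s i) : 0 ≤ T.cost a s :=
  Real.rpow_nonneg (Real.sInf_nonneg fun _ hv => T.costSet_nonneg a hs hv) _

theorem cost_rpow (a : Fin din → ℝ) {s : Fin din → ℝ} (hs : ∀ i, 0 < s i) :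
    T.cost a s ^ (2 / 3 : ℝ) = sInf (T.costSet a s) := by
  rw [cost, ← Real.rpow_mul (Real.sInf_nonneg fun _ hv => T.costSet_nonneg a hs hv)]
  norm_num

/-- The scaling of a parallel sum built from scalings of the summands and weights `x`, `y`. -/
def mergeScaling {m n : ℕ} (x y : ℝ) (D : Fin (m + 1) → ℝ) (E : Fin (n + 1) → ℝ) :
    Fin (m + n + 1) → ℝ :=
  join (fun i => x⁻¹ * D i.castSucc) (fun i => y⁻¹ * E i.castSucc)
    (x⁻¹ * D (Fin.last _) + y⁻¹ * E (Fin.last _))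

theorem mergeScaling_pos {m n : ℕ} {x y : ℝ} (hx : 0 < x) (hy : 0 < y) {D : Fin (m + 1) → ℝ}
    {E : Fin (n + 1) → ℝ} (hD : ∀ i, 0 < D i) (hE : ∀ i, 0 < E i) (i) :
    0 < mergeScaling x y D E i := by
  have h1 := fun i => mul_pos (inv_pos.2 hx) (hD i)
  have h2 := fun i => mul_pos (inv_pos.2 hy) (hE i)
  revert i
  refine forall_hidden (fun i => ?_) (fun i => ?_) ?_ <;>
    simp only [mergeScaling, join_left, join_right, join_last]
  exacts [h1 _, h2 _, add_pos (h1 _) (h2 _)]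

theorem weighted_euclNorm_le {m n : ℕ} {x y : ℝ} (hx : 0 < x) (hy : 0 < y)
    {D : Fin (m + 1) → ℝ} {E : Fin (n + 1) → ℝ} (hD : ∀ i, 0 < D i) (hE : ∀ i, 0 < E i)
    (z : Fin (m + n + 1) → ℝ) :
    (x⁻¹ * euclNorm (fun i => D i * restrictLeft (fun j => (mergeScaling x y D E j)⁻¹ * z j) i)) ^ 2
      + (y⁻¹ * euclNorm
          (fun i => E i * restrictRight (fun j => (mergeScaling x y D E j)⁻¹ * z j) i)) ^ 2
      ≤ euclNorm z ^ 2 := by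
  have hl : ∀ i : Fin m, (x⁻¹ * (D i.castSucc * ((x⁻¹ * D i.castSucc)⁻¹ *
      z (Fin.castAdd n i).castSucc))) ^ 2 = z (Fin.castAdd n i).castSucc ^ 2 := fun i => by
    have := (hD i.castSucc).ne'
    field_simp
  have hr : ∀ i : Fin n, (y⁻¹ * (E i.castSucc * ((y⁻¹ * E i.castSucc)⁻¹ *
      z (Fin.natAdd m i).castSucc))) ^ 2 = z (Fin.natAdd m i).castSucc ^ 2 := fun i => by
    have := (hE i.castSucc).ne'
    field_simp
  have hlast : ∀ p q t : ℝ, 0 < p → 0 < q →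
      (p * ((p + q)⁻¹ * t)) ^ 2 + (q * ((p + q)⁻¹ * t)) ^ 2 ≤ t ^ 2 := fun p q t hp hq => by
    have h : (p * ((p + q)⁻¹ * t)) ^ 2 + (q * ((p + q)⁻¹ * t)) ^ 2 =
        (p ^ 2 + q ^ 2) / (p + q) ^ 2 * t ^ 2 := by
      field_simp
    rw [h]
    refine mul_le_of_le_one_left (sq_nonneg t) ((div_le_one (by positivity)).2 ?_)
    nlinarith [mul_pos hp hq]
  have hlast' := hlast _ _ (z (Fin.last _)) (mul_pos (inv_pos.2 hx) (hD (Fin.last _)))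
    (mul_pos (inv_pos.2 hy) (hE (Fin.last _)))
  simp only [mul_pow _ (euclNorm _), euclNorm_sq, Finset.mul_sum, ← mul_pow x⁻¹, ← mul_pow y⁻¹]
  rw [sum_hidden, Fin.sum_univ_castSucc, Fin.sum_univ_castSucc]
  simp only [restrictLeft, restrictRight, Fin.snoc_castSucc, Fin.snoc_last, mergeScaling,
    join_left, join_right, join_last, hl, hr]
  simp only [mul_assoc] at hlast' ⊢
  linarith

theorem add_le_of_weighted {x y p q S : ℝ} (hx : 0 < x) (hy : 0 < y) (hxy : x ^ 2 + y ^ 2 ≤ 1)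
    (hS : 0 ≤ S) (h : (x⁻¹ * p) ^ 2 + (y⁻¹ * q) ^ 2 ≤ S ^ 2) : p + q ≤ S := by
  have hp : p = x * (x⁻¹ * p) := (mul_inv_cancel_left₀ hx.ne' p).symm
  have hq : q = y * (y⁻¹ * q) := (mul_inv_cancel_left₀ hy.ne' q).symm
  generalize x⁻¹ * p = p' at *
  generalize y⁻¹ * q = q' at *
  subst hp hq
  refine abs_le_of_sq_le_sq' ?_ hS |>.2
  nlinarith [sq_nonneg (x * q' - y * p'),
    mul_nonneg (sub_nonneg.2 hxy) (add_nonneg (sq_nonneg p') (sq_nonneg q'))]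

section parallel

variable (T₁ T₂ : ResNet din dout)

theorem sum_inner_parallel_left (a s : Fin din → ℝ) (ℓ : ℕ) (k : Fin T₁.w) :
    ∑ j, |(T₁.parallel T₂).inner ℓ (Fin.castAdd T₂.w k) j| * (T₁.parallel T₂).Csup a s ℓ j =
      ∑ j, |T₁.inner ℓ k j| * T₁.Csup a s ℓ j := by
  rw [← restrictLeft_Csup T₁ T₂, ← sum_extendLeft_mul, parallel_inner]
  simp [abs_extendLeft]

theorem sum_inner_parallel_right (a s : Fin din → ℝ) (ℓ : ℕ) (k : Fin T₂.w) :
    ∑ j, |(T₁.parallel T₂).inner ℓ (Fin.natAdd T₁.w k) j| * (T₁.parallel T₂).Csup a s ℓ j =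
      ∑ j, |T₂.inner ℓ k j| * T₂.Csup a s ℓ j := by
  rw [← restrictRight_Csup T₁ T₂, ← sum_extendRight_mul, parallel_inner]
  simp [abs_extendRight]

theorem parallel_blockCost (a s : Fin din → ℝ) (ℓ : ℕ) (x y : ℝ) (D : Fin (T₁.d + 1) → ℝ)
    (E : Fin (T₂.d + 1) → ℝ) :
    (T₁.parallel T₂).blockCost a s ℓ (mergeScaling x y D E) =
      x⁻¹ * T₁.blockCost a s ℓ D + y⁻¹ * T₂.blockCost a s ℓ E := by
  rw [blockCost_eq, blockCost_eq T₁, blockCost_eq T₂, Finset.mul_sum, Finset.mul_sum]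
  refine (Fin.sum_univ_add _).trans (congrArg₂ _ ?_ ?_)
  · refine Finset.sum_congr rfl fun i _ => ?_
    rw [mergeScaling, join_left, mul_assoc, Fin.sum_univ_add]
    simp [sum_inner_parallel_left, parallel_outer]
  · refine Finset.sum_congr rfl fun i _ => ?_
    rw [mergeScaling, join_right, mul_assoc, Fin.sum_univ_add]
    simp [sum_inner_parallel_right, parallel_outer]

theorem parallel_inputCost (s : Fin din → ℝ) (x y : ℝ) (D : Fin (T₁.d + 1) → ℝ)
    (E : Fin (T₂.d + 1) → ℝ) :
    (T₁.parallel T₂).inputCost s (mergeScaling x y D E) =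
      x⁻¹ * T₁.inputCost s D + y⁻¹ * T₂.inputCost s E := by
  simp only [inputCost, Finset.mul_sum]
  refine (Fin.sum_univ_add _).trans (congrArg₂ _ ?_ ?_) <;>
    refine Finset.sum_congr rfl fun i _ => Finset.sum_congr rfl fun j _ => ?_
  · rw [mergeScaling, join_left, Fin.append_left]
    ring
  · rw [mergeScaling, join_right, Fin.append_right]
    ring

theorem parallel_stageCost (a s : Fin din → ℝ) (ℓ : ℕ) (x y : ℝ) (D : Fin (T₁.d + 1) → ℝ)
    (E : Fin (T₂.d + 1) → ℝ) :
    (T₁.parallel T₂).stageCost a s ℓ (mergeScaling x y D E) =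
      x⁻¹ * T₁.stageCost a s ℓ D + y⁻¹ * T₂.stageCost a s ℓ E := by
  cases ℓ with
  | zero => exact parallel_inputCost T₁ T₂ s x y D E
  | succ ℓ => exact parallel_blockCost T₁ T₂ a s ℓ x y D E

theorem Csup_of_ge (a s : Fin din → ℝ) {ℓ : ℕ} (h : T.L ≤ ℓ) :
    T.Csup a s ℓ = T.Csup a s T.L := by
  ext i
  simp only [Csup, T.act_of_ge _ h]

theorem parallel_outputCost_le (a s : Fin din → ℝ) :
    (T₁.parallel T₂).outputCost a s ≤ T₁.outputCost a s + T₂.outputCost a s := by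
  rw [outputCost, outputCost, outputCost, ← Finset.sum_add_distrib]
  refine Finset.sum_le_sum fun o _ => ?_
  rw [← T₁.Csup_of_ge a s (le_max_left T₁.L T₂.L), ← T₂.Csup_of_ge a s (le_max_right T₁.L T₂.L),
    ← restrictLeft_Csup T₁ T₂, ← restrictRight_Csup T₁ T₂, ← sum_extendLeft_mul,
    ← sum_extendRight_mul, ← Finset.sum_add_distrib]
  refine Finset.sum_le_sum fun j _ => ?_
  rw [← abs_extendLeft, ← abs_extendRight, ← add_mul]
  exact mul_le_mul_of_nonneg_right (abs_add_le _ _) ((T₁.parallel T₂).Csup_nonneg a s _ j)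

variable {T₁ T₂}

theorem Admissible.parallel {D : ℕ → Fin (T₁.d + 1) → ℝ} {E : ℕ → Fin (T₂.d + 1) → ℝ}
    (hD : T₁.Admissible D) (hE : T₂.Admissible E) {x y : ℕ → ℝ} (hx : ∀ ℓ, 0 < x ℓ)
    (hy : ∀ ℓ, 0 < y ℓ) (hxy : ∀ ℓ, x ℓ ^ 2 + y ℓ ^ 2 ≤ 1) :
    (T₁.parallel T₂).Admissible
      (fun ℓ => mergeScaling (x ℓ) (y ℓ) (D (min ℓ T₁.L)) (E (min ℓ T₂.L))) := by
  refine ⟨fun ℓ => mergeScaling_pos (hx ℓ) (hy ℓ) (hD.1 _) (hE.1 _), fun ℓ hℓ z z' => ?_⟩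
  obtain ⟨n, hn⟩ := Nat.exists_eq_add_of_le hℓ
  have h1 := hD.lipWith_blocks (ℓ := ℓ) (n := n) (hn ▸ le_max_left T₁.L T₂.L)
  have h2 := hE.lipWith_blocks (ℓ := ℓ) (n := n) (hn ▸ le_max_right T₁.L T₂.L)
  have hDpos := hD.1 (min ℓ T₁.L)
  have hEpos := hE.1 (min ℓ T₂.L)
  have hw := weighted_euclNorm_le (hx ℓ) (hy ℓ) hDpos hEpos (fun i => z i - z' i)
  have hsum := add_le_of_weighted (hx ℓ) (hy ℓ) (hxy ℓ) (euclNorm_nonneg _) hw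
  beta_reduce
  generalize D (min ℓ T₁.L) = D₁ at *
  generalize E (min ℓ T₂.L) = D₂ at *
  have hleft : ∀ w : Fin (T₁.d + T₂.d + 1) → ℝ,
      T₁.Wout.mulVec (T₁.blocks ℓ n (restrictLeft w)) = T₁.Wout.mulVec
        (T₁.blocks ℓ n (fun i => (D₁ i)⁻¹ * (D₁ i * restrictLeft w i))) := fun w => by
    simp only [inv_mul_cancel_left₀ (hDpos _).ne']
  have hright : ∀ w : Fin (T₁.d + T₂.d + 1) → ℝ,
      T₂.Wout.mulVec (T₂.blocks ℓ n (restrictRight w)) = T₂.Wout.mulVec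
        (T₂.blocks ℓ n (fun i => (D₂ i)⁻¹ * (D₂ i * restrictRight w i))) := fun w => by
    simp only [inv_mul_cancel_left₀ (hEpos _).ne']
  have hsplit : ∀ (w : Fin (T₁.d + T₂.d + 1) → ℝ) (o : Fin dout),
      (T₁.parallel T₂).Wout.mulVec ((T₁.parallel T₂).tailAct ℓ w) o =
        T₁.Wout.mulVec (T₁.blocks ℓ n (restrictLeft w)) o +
          T₂.Wout.mulVec (T₂.blocks ℓ n (restrictRight w)) o := fun w o => by
    rw [tailAct_eq_blocks _ ℓ n hn.symm, parallel_Wout_mulVec, restrictLeft_blocks,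
      restrictRight_blocks]
  rw [one_mul]
  refine (congrArg euclNorm (funext fun o => (congrArg₂ (· - ·) (hsplit _ o) (hsplit _ o)).trans
    (add_sub_add_comm _ _ _ _))).trans_le ?_
  refine (euclNorm_add_le _ _).trans (le_trans (add_le_add ?_ ?_) hsum)
  · rw [hleft, hleft]
    refine (h1 _ _).trans (le_of_eq ?_)
    rw [one_mul]
    congr 1
    ext i
    refine Fin.lastCases ?_ (fun i => ?_) i <;>
      simp only [restrictLeft, Fin.snoc_castSucc, Fin.snoc_last] <;> ring
  · rw [hright, hright]
    refine (h2 _ _).trans (le_of_eq ?_)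
    rw [one_mul]
    congr 1
    ext i
    refine Fin.lastCases ?_ (fun i => ?_) i <;>
      simp only [restrictRight, Fin.snoc_castSucc, Fin.snoc_last] <;> ring

end parallel


/-! ### Optimal weights -/

theorem le_sqrt_mul_of_rpow_le {A p : ℝ} (hA : 0 ≤ A) (hp : A ^ (2 / 3 : ℝ) ≤ p) :
    A ≤ √p * p := by
  have hp0 : 0 ≤ p := (Real.rpow_nonneg hA _).trans hp
  have h := Real.rpow_le_rpow (Real.rpow_nonneg hA _) hp (by norm_num : (0 : ℝ) ≤ 3 / 2)
  rw [← Real.rpow_mul hA] at h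
  norm_num at h
  refine h.trans_eq ?_
  rw [Real.sqrt_eq_rpow, ← Real.rpow_add_one' hp0 (by norm_num)]
  norm_num

theorem exists_weights {A B δ : ℝ} (hA : 0 ≤ A) (hB : 0 ≤ B) (hδ : 0 < δ) :
    ∃ x y : ℝ, 0 < x ∧ 0 < y ∧ x ^ 2 + y ^ 2 ≤ 1 ∧
      (x⁻¹ * A + y⁻¹ * B) ^ (2 / 3 : ℝ) ≤ A ^ (2 / 3 : ℝ) + B ^ (2 / 3 : ℝ) + δ := by
  obtain ⟨p, hp⟩ : ∃ p, p = A ^ (2 / 3 : ℝ) + δ / 2 := ⟨_, rfl⟩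
  obtain ⟨q, hq⟩ : ∃ q, q = B ^ (2 / 3 : ℝ) + δ / 2 := ⟨_, rfl⟩
  have hA' := Real.rpow_nonneg hA (2 / 3)
  have hB' := Real.rpow_nonneg hB (2 / 3)
  have hp0 : 0 < p := by linarith
  have hq0 : 0 < q := by linarith
  have hP : 0 < p + q := add_pos hp0 hq0
  have hterm : ∀ t C : ℝ, 0 < t → C ≤ √t * t → (√(t / (p + q)))⁻¹ * C ≤ √(p + q) * t := by
    intro t C ht hC
    rw [Real.sqrt_div ht.le, inv_div, div_mul_eq_mul_div, div_le_iff₀ (Real.sqrt_pos.2 ht),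
      mul_assoc, mul_comm t]
    exact mul_le_mul_of_nonneg_left hC (Real.sqrt_nonneg _)
  refine ⟨√(p / (p + q)), √(q / (p + q)), Real.sqrt_pos.2 (by positivity),
    Real.sqrt_pos.2 (by positivity), ?_, ?_⟩
  · rw [Real.sq_sqrt (by positivity), Real.sq_sqrt (by positivity), ← add_div, div_self hP.ne']
  · have h := add_le_add (hterm p A hp0 (le_sqrt_mul_of_rpow_le hA (by linarith)))
      (hterm q B hq0 (le_sqrt_mul_of_rpow_le hB (by linarith)))
    refine (Real.rpow_le_rpow (by positivity) h (by norm_num)).trans (le_of_eq ?_)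
    rw [← mul_add, Real.sqrt_eq_rpow, ← Real.rpow_add_one' hP.le (by norm_num),
      ← Real.rpow_mul hP.le, hp, hq]
    norm_num
    ring

theorem sInf_costSet_parallel_le (T₁ T₂ : ResNet din dout) (a : Fin din → ℝ) {s : Fin din → ℝ}
    (hs : ∀ i, 0 < s i) :
    sInf ((T₁.parallel T₂).costSet a s) ≤ sInf (T₁.costSet a s) + sInf (T₂.costSet a s) := by
  suffices H : ∀ v₁ ∈ T₁.costSet a s, ∀ v₂ ∈ T₂.costSet a s,
      sInf ((T₁.parallel T₂).costSet a s) ≤ v₁ + v₂ by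
    rw [← sub_le_iff_le_add]
    refine le_csInf (T₁.costSet_nonempty a s) fun v₁ h₁ => ?_
    rw [sub_le_iff_le_add, ← sub_le_iff_le_add']
    refine le_csInf (T₂.costSet_nonempty a s) fun v₂ h₂ => ?_
    rw [sub_le_iff_le_add']
    exact H v₁ h₁ v₂ h₂
  intro v₁ h₁ v₂ h₂
  obtain ⟨D, hD, rfl⟩ := (T₁.mem_costSet_iff a s (le_max_left T₁.L T₂.L)).1 h₁
  obtain ⟨E, hE, rfl⟩ := (T₂.mem_costSet_iff a s (le_max_right T₁.L T₂.L)).1 h₂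
  refine le_of_forall_pos_le_add fun δ hδ => ?_
  have hA := fun ℓ => T₁.stageCost_nonneg a hs ℓ (hD.1 (min ℓ T₁.L))
  have hB := fun ℓ => T₂.stageCost_nonneg a hs ℓ (hE.1 (min ℓ T₂.L))
  have hδ' : 0 < δ / ((max T₁.L T₂.L + 1 : ℕ) : ℝ) := by positivity
  choose x y hx hy hxy hle using fun ℓ => exists_weights (hA ℓ) (hB ℓ) hδ'
  have hmem := ((T₁.parallel T₂).mem_costSet_iff a s le_rfl).2
    ⟨_, hD.parallel hE hx hy hxy, rfl⟩
  refine (csInf_le ⟨0, fun v hv => costSet_nonneg _ a hs hv⟩ hmem).trans ?_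
  have hout : (T₁.parallel T₂).outputCost a s ^ (2 / 3 : ℝ) ≤
      T₁.outputCost a s ^ (2 / 3 : ℝ) + T₂.outputCost a s ^ (2 / 3 : ℝ) :=
    (Real.rpow_le_rpow (outputCost_nonneg _ a s) (parallel_outputCost_le T₁ T₂ a s)
      (by norm_num)).trans
      (Real.rpow_add_le_add_rpow (T₁.outputCost_nonneg a s) (T₂.outputCost_nonneg a s)
        (by norm_num) (by norm_num))
  have hsum := Finset.sum_le_sum fun ℓ (_ : ℓ ∈ Finset.range (max T₁.L T₂.L + 1)) => hle ℓ
  rw [Finset.sum_add_distrib, Finset.sum_add_distrib, Finset.sum_const, Finset.card_range,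
    nsmul_eq_mul, mul_div_cancel₀ _ (by positivity)] at hsum
  refine (add_le_add (le_trans (le_of_eq ?_) hsum) hout).trans_eq (by ring)
  refine Finset.sum_congr rfl fun ℓ hℓ => ?_
  rw [min_eq_left (Finset.mem_range_succ_iff.1 hℓ), parallel_stageCost]

theorem cost_parallel_rpow_le (T₁ T₂ : ResNet din dout) (a : Fin din → ℝ) {s : Fin din → ℝ}
    (hs : ∀ i, 0 < s i) :
    (T₁.parallel T₂).cost a s ^ (2 / 3 : ℝ) ≤
      T₁.cost a s ^ (2 / 3 : ℝ) + T₂.cost a s ^ (2 / 3 : ℝ) := by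
  rw [cost_rpow _ a hs, cost_rpow _ a hs, cost_rpow _ a hs]
  exact sInf_costSet_parallel_le T₁ T₂ a hs

end ResNet

/-! ### Approximation complexities -/

section

variable {din dout : ℕ} {a s : Fin din → ℝ} {N : ((Fin din → ℝ) → Fin dout → ℝ) → ℝ}
  {f g : (Fin din → ℝ) → Fin dout → ℝ}

theorem RApproxSet_nonneg (hs : ∀ i, 0 < s i) {ε r : ℝ} (hr : r ∈ RApproxSet a s N f ε) :
    0 ≤ r := by
  obtain ⟨T, -, rfl⟩ := hr
  exact T.cost_nonneg a hs

theorem exists_mem_RApproxSet_add (hs : ∀ i, 0 < s i)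
    (hNadd : ∀ g h : (Fin din → ℝ) → Fin dout → ℝ, N (fun x o => g x o + h x o) ≤ N g + N h)
    {ε₁ ε₂ r₁ r₂ : ℝ} (h₁ : r₁ ∈ RApproxSet a s N f ε₁) (h₂ : r₂ ∈ RApproxSet a s N g ε₂) :
    ∃ r ∈ RApproxSet a s N (fun x o => f x o + g x o) (ε₁ + ε₂),
      r ^ (2 / 3 : ℝ) ≤ r₁ ^ (2 / 3 : ℝ) + r₂ ^ (2 / 3 : ℝ) := by
  obtain ⟨T₁, hT₁, rfl⟩ := h₁
  obtain ⟨T₂, hT₂, rfl⟩ := h₂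
  refine ⟨_, ⟨T₁.parallel T₂, ?_, rfl⟩, ResNet.cost_parallel_rpow_le T₁ T₂ a hs⟩
  simp only [ResNet.parallel_fn, add_sub_add_comm]
  exact (hNadd _ _).trans (add_le_add hT₁ hT₂)

theorem RNormSet_nonneg (hs : ∀ i, 0 < s i) {ω v : ℝ} (hv : v ∈ RNormSet a s ω N f) : 0 ≤ v := by
  obtain ⟨ε, hε, rfl⟩ := hv
  exact mul_nonneg (Real.rpow_nonneg hε.le _)
    (Real.sInf_nonneg fun _ hr => RApproxSet_nonneg hs hr)

/-- A finite norm provides networks of every accuracy with controlled complexity. -/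
theorem RNormFin.exists_mem_lt {ω : ℝ} (hf : RNormFin a s ω N f) {ε K : ℝ} (hε : 0 < ε)
    (hK : sSup (RNormSet a s ω N f) < ε ^ (ω - 1) * K) : ∃ r ∈ RApproxSet a s N f ε, r < K := by
  refine exists_lt_of_csInf_lt (hf.1 ε hε) ?_
  have h := le_csSup hf.2 ⟨ε, hε, rfl⟩
  exact lt_of_mul_lt_mul_left (h.trans_lt hK) (Real.rpow_nonneg hε.le _)

/-- Splitting the accuracy `ε` proportionally to `p` and `q`. -/
theorem exists_mem_RApproxSet_add_le (hs : ∀ i, 0 < s i)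
    (hNadd : ∀ g h : (Fin din → ℝ) → Fin dout → ℝ, N (fun x o => g x o + h x o) ≤ N g + N h)
    {ω : ℝ} (hf : RNormFin a s ω N f) (hg : RNormFin a s ω N g) {ε p q : ℝ} (hε : 0 < ε)
    (hp : 0 < p) (hq : 0 < q) (hfp : sSup (RNormSet a s ω N f) < p ^ ((1 + 2 * ω) / 2))
    (hgq : sSup (RNormSet a s ω N g) < q ^ ((1 + 2 * ω) / 2)) :
    ∃ r ∈ RApproxSet a s N (fun x o => f x o + g x o) ε,
      ε ^ (ω - 1) * r ≤ (p + q) ^ ((1 + 2 * ω) / 2) := by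
  have hP : 0 < p + q := add_pos hp hq
  have hc : 0 < ε / (p + q) := div_pos hε hP
  have hsplit : ∀ t : ℝ, 0 < t → t ^ ((1 + 2 * ω) / 2) =
      (ε / (p + q) * t) ^ (ω - 1) * ((ε / (p + q)) ^ (1 - ω) * t ^ (3 / 2 : ℝ)) := fun t ht => by
    rw [Real.mul_rpow hc.le ht.le, mul_mul_mul_comm, ← Real.rpow_add hc, ← Real.rpow_add ht,
      sub_add_sub_cancel, sub_self, Real.rpow_zero, one_mul]
    congr 1
    ring
  have hpow : ∀ t : ℝ, 0 < t → ((ε / (p + q)) ^ (1 - ω) * t ^ (3 / 2 : ℝ)) ^ (2 / 3 : ℝ) =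
      ((ε / (p + q)) ^ (1 - ω)) ^ (2 / 3 : ℝ) * t := fun t ht => by
    rw [Real.mul_rpow (Real.rpow_nonneg hc.le _) (Real.rpow_nonneg ht.le _),
      ← Real.rpow_mul ht.le]
    norm_num
  rw [hsplit p hp] at hfp
  rw [hsplit q hq] at hgq
  obtain ⟨r₁, hr₁, hlt₁⟩ := hf.exists_mem_lt (mul_pos hc hp) hfp
  obtain ⟨r₂, hr₂, hlt₂⟩ := hg.exists_mem_lt (mul_pos hc hq) hgq
  obtain ⟨r, hr, hle⟩ := exists_mem_RApproxSet_add hs hNadd hr₁ hr₂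
  rw [← mul_add, div_mul_cancel₀ _ hP.ne'] at hr
  refine ⟨r, hr, ?_⟩
  have h₁ := Real.rpow_le_rpow (RApproxSet_nonneg hs hr₁) hlt₁.le
    (by norm_num : (0 : ℝ) ≤ 2 / 3)
  have h₂ := Real.rpow_le_rpow (RApproxSet_nonneg hs hr₂) hlt₂.le
    (by norm_num : (0 : ℝ) ≤ 2 / 3)
  have h := hle.trans (add_le_add h₁ h₂)
  rw [hpow p hp, hpow q hq, ← mul_add, ← hpow _ hP,
    Real.rpow_le_rpow_iff (RApproxSet_nonneg hs hr) (by positivity) (by norm_num)] at h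
  refine (mul_le_mul_of_nonneg_left h (Real.rpow_nonneg hε.le _)).trans_eq ?_
  rw [hsplit _ hP, div_mul_cancel₀ _ hP.ne']

theorem sSup_RNormSet_add_le (hs : ∀ i, 0 < s i)
    (hNadd : ∀ g h : (Fin din → ℝ) → Fin dout → ℝ, N (fun x o => g x o + h x o) ≤ N g + N h)
    {ω : ℝ} (hω : 1 ≤ ω) (hf : RNormFin a s ω N f) (hg : RNormFin a s ω N g) :
    sSup (RNormSet a s ω N (fun x o => f x o + g x o)) ≤
      (sSup (RNormSet a s ω N f) ^ (2 / (1 + 2 * ω)) +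
        sSup (RNormSet a s ω N g) ^ (2 / (1 + 2 * ω))) ^ ((1 + 2 * ω) / 2) := by
  have hF : 0 ≤ sSup (RNormSet a s ω N f) := Real.sSup_nonneg fun _ hv => RNormSet_nonneg hs hv
  have hG : 0 ≤ sSup (RNormSet a s ω N g) := Real.sSup_nonneg fun _ hv => RNormSet_nonneg hs hv
  have hexp : 0 < (1 + 2 * ω) / 2 := by positivity
  have hlt : ∀ {F δ : ℝ}, 0 ≤ F → 0 < δ →
      F < (F ^ (2 / (1 + 2 * ω)) + δ) ^ ((1 + 2 * ω) / 2) := fun {F δ} hF hδ => by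
    have h := Real.rpow_lt_rpow (Real.rpow_nonneg hF _)
      (lt_add_of_pos_right (F ^ (2 / (1 + 2 * ω))) hδ) hexp
    rwa [← inv_div, Real.rpow_inv_rpow hF hexp.ne', inv_div] at h
  refine Real.sSup_le ?_ (by positivity)
  rintro _ ⟨ε, hε, rfl⟩
  have hcont : ContinuousAt (fun δ : ℝ =>
      (sSup (RNormSet a s ω N f) ^ (2 / (1 + 2 * ω)) + δ +
        (sSup (RNormSet a s ω N g) ^ (2 / (1 + 2 * ω)) + δ)) ^ ((1 + 2 * ω) / 2)) 0 :=
    ContinuousAt.rpow_const (by fun_prop) (Or.inr hexp.le)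
  have hlim := hcont.tendsto.mono_left (nhdsWithin_le_nhds (s := Set.Ioi 0))
  simp only [add_zero] at hlim
  refine ge_of_tendsto hlim ?_
  filter_upwards [self_mem_nhdsWithin] with δ hδ
  obtain ⟨r, hr, hle⟩ := exists_mem_RApproxSet_add_le hs hNadd hf hg hε
    (add_pos_of_nonneg_of_pos (Real.rpow_nonneg hF _) hδ)
    (add_pos_of_nonneg_of_pos (Real.rpow_nonneg hG _) hδ) (hlt hF hδ) (hlt hG hδ)
  refine le_trans (mul_le_mul_of_nonneg_left ?_ (Real.rpow_nonneg hε.le _)) hle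
  exact csInf_le ⟨0, fun _ hv => RApproxSet_nonneg hs hv⟩ hr

end

end

/-- point 3 of Proposition `properties_ResNet_norm`: approximate
subadditivity of the ResNet norm under addition,
`‖f+g‖_{R^ω} ≤ (‖f‖_{R^ω}^{2ω/(1+2ω)} + ‖g‖_{R^ω}^{2ω/(1+2ω)})^{(1+2ω)/(2ω)}`. -/
theorem rnorm_subadditive {din dout : ℕ} (a s : Fin din → ℝ) (hs : ∀ i, 0 < s i)
    (N : ((Fin din → ℝ) → Fin dout → ℝ) → ℝ)
    (hN0 : ∀ g, 0 ≤ N g)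
    (hNadd : ∀ g h : (Fin din → ℝ) → Fin dout → ℝ,
      N (fun x o => g x o + h x o) ≤ N g + N h)
    (ω : ℝ) (hω : 1 ≤ ω)
    (f g : (Fin din → ℝ) → Fin dout → ℝ)
    (hf : RNormFin a s ω N f) (hg : RNormFin a s ω N g) :
    RNorm a s ω N (fun x o => f x o + g x o)
      ≤ (RNorm a s ω N f ^ (2 * ω / (1 + 2 * ω))
          + RNorm a s ω N g ^ (2 * ω / (1 + 2 * ω))) ^ ((1 + 2 * ω) / (2 * ω)) := by
  have hω0 : 0 < ω := one_pos.trans_le hω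
  have hnonneg : ∀ f : (Fin din → ℝ) → Fin dout → ℝ, 0 ≤ sSup (RNormSet a s ω N f) :=
    fun f => Real.sSup_nonneg fun _ hv => RNormSet_nonneg hs hv
  have hexp : ∀ f : (Fin din → ℝ) → Fin dout → ℝ,
      RNorm a s ω N f ^ (2 * ω / (1 + 2 * ω)) =
        sSup (RNormSet a s ω N f) ^ (2 / (1 + 2 * ω)) := fun f => by
    rw [RNorm, ← Real.rpow_mul (hnonneg f)]
    congr 1
    field_simp
  rw [hexp, hexp]
  refine (Real.rpow_le_rpow (hnonneg _) (sSup_RNormSet_add_le hs hNadd hω hf hg)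
    (inv_nonneg.2 hω0.le)).trans_eq ?_
  rw [← Real.rpow_mul (add_nonneg (Real.rpow_nonneg (hnonneg f) _)
    (Real.rpow_nonneg (hnonneg g) _))]
  congr 1
  field_simp
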